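/- Let n ≥ 1, let l : Fin n → ℝ be a logit vector with softmax distribution π, fix a sampled token o ∈ Fin n and a constant c ∈ ℝ, and define the logit update direction v(y) = c·(𝟙{y = o} − π(y)). Then for every y ∈ Fin n the function t ↦ softmax(l + t·v)(y) has derivative at t = 0 equal to c·π(y)·(𝟙{y = o} − π(y) − π(o) + Σ_{z} π(z)²). -/

import Mathlib

/-- The softmax distribution of a logit vector. -/
noncomputable def softmax {n : ℕ} (l : Fin n → ℝ) : Fin n → ℝ :=
  fun y => Real.exp (l y) / ∑ z, Real.exp (l z)

theorem softmax_dir_aux {n : ℕ} (hn : 1 ≤ n) (l v : Fin n → ℝ) (y : Fin n) :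
    HasDerivAt (fun t : ℝ => softmax (fun i => l i + t * v i) y)
      (softmax l y * (v y - ∑ z, softmax l z * v z)) 0 := by
  have hS : 0 < ∑ z, Real.exp (l z) :=
    Finset.sum_pos (fun z _ => Real.exp_pos _) ⟨y, Finset.mem_univ y⟩
  have he : ∀ i, HasDerivAt (fun t : ℝ => Real.exp (l i + t * v i)) (Real.exp (l i) * v i) 0 := by
    intro i
    have h := (((hasDerivAt_id (0 : ℝ)).mul_const (v i)).const_add (l i)).exp
    simpa using h
  have hs : HasDerivAt (fun t : ℝ => ∑ i, Real.exp (l i + t * v i))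
      (∑ i, Real.exp (l i) * v i) 0 := HasDerivAt.fun_sum (fun i _ => he i)
  have h := (he y).fun_div hs (by simpa using hS.ne')
  unfold softmax
  refine h.congr_deriv ?_
  have e : ∑ z, Real.exp (l z) / (∑ z, Real.exp (l z)) * v z
      = (∑ z, Real.exp (l z) * v z) / ∑ z, Real.exp (l z) := by
    rw [Finset.sum_div]
    exact Finset.sum_congr rfl (fun z _ => by ring)
  simp only [e]
  simp only [zero_mul, add_zero]
  have := hS.ne'
  field_simp

/-- Derivative of softmax along the policy-gradient update direction
`v y = c * (𝟙{y = o} - π y)`: for every token `y`, the map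
`t ↦ softmax (l + t • v) y` has derivative at `t = 0` equal to
`c * π y * (𝟙{y = o} - π y - π o + ∑ z, (π z)²)` where `π = softmax l`. -/
theorem softmax_deriv_update_direction {n : ℕ} (hn : 1 ≤ n) (l : Fin n → ℝ)
    (o : Fin n) (c : ℝ) (y : Fin n) :
    HasDerivAt
      (fun t : ℝ =>
        softmax (fun i => l i + t * (c * ((if i = o then 1 else 0) - softmax l i))) y)
      (c * softmax l y *
        ((if y = o then (1 : ℝ) else 0) - softmax l y - softmax l o +
          ∑ z, (softmax l z) ^ 2)) 0 := by
  have h := softmax_dir_aux hn l (fun i => c * ((if i = o then 1 else 0) - softmax l i)) y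
  refine h.congr_deriv ?_
  have e : ∑ z, softmax l z * (c * ((if z = o then 1 else 0) - softmax l z))
      = c * (softmax l o - ∑ z, softmax l z ^ 2) := by
    have : ∀ z, softmax l z * (c * ((if z = o then 1 else 0) - softmax l z))
        = c * ((if z = o then softmax l z else 0) - softmax l z ^ 2) := by
      intro z
      split_ifs <;> ring
    simp only [this]
    rw [← Finset.mul_sum, Finset.sum_sub_distrib]
    simp
  simp only [e]
  ring
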